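/- In the warden's game with n dice each having m sides (m ≥ 1, n ≥ 1), let w* : ZMod (m^n) → Fin m be the warden's sequence, i.e., a sequence such that for every k ∈ ZMod (m^n) the window W(w*, k) equals the unique position x with r̃(x) = ((k̄ + n − 1) mod m^n) + 1, where k̄ is the canonical representative of k. Then w* is the lexicographically minimal m-ary de Bruijn sequence of rank n: for every m-ary de Bruijn sequence f of rank n and every j ∈ ZMod (m^n), the word (w* 0, w* 1, …, w* (m^n − 1)) is lexicographically less than or equal to the word (f j, f (j+1), …, f (j + m^n − 1)). -/

import Mathlib

/-- One move: the rightmost entry is transferred to the far left, becoming `c`,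
producing `(c, x₀, …, x_{n−2})`. -/
def shift {α : Type*} {n : ℕ} (c : α) (x : Fin n → α) : Fin n → α :=
  fun i => if _h : (i : ℕ) = 0 then c
    else x ⟨(i : ℕ) - 1, lt_of_le_of_lt (Nat.sub_le _ _) i.isLt⟩

/-- The goal position: every die shows `m - 1`. -/
def goalPos (m n : ℕ) (hm : 1 ≤ m) : Fin n → Fin m :=
  fun _ => ⟨m - 1, Nat.sub_lt hm Nat.one_pos⟩

/-- `CanWin m n hm hn N x`: the prisoner can force the goal within `N` moves from
position `x`.  It holds iff `x` is the goal, or `N ≥ 1` and both: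
(i) for every warden choice `c < x_{n-1}`, `CanWin (N-1)` holds at `(c, x₀, …, x_{n−2})`, and
(ii) there is a prisoner choice `c ≥ x_{n-1}` with `CanWin (N-1)` at `(c, x₀, …, x_{n−2})`. -/
def CanWin (m n : ℕ) (hm : 1 ≤ m) (hn : 1 ≤ n) : ℕ → (Fin n → Fin m) → Prop
  | 0, x => x = goalPos m n hm
  | N + 1, x => x = goalPos m n hm ∨
      ((∀ c : Fin m, c < x ⟨n - 1, Nat.sub_lt hn Nat.one_pos⟩ →
          CanWin m n hm hn N (shift c x)) ∧
       ∃ c : Fin m, x ⟨n - 1, Nat.sub_lt hn Nat.one_pos⟩ ≤ c ∧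
          CanWin m n hm hn N (shift c x))

/-- The remoteness of a position: the least `N` with `CanWin N x`. -/
noncomputable def remoteness (m n : ℕ) (hm : 1 ≤ m) (hn : 1 ≤ n)
    (x : Fin n → Fin m) : ℕ :=
  sInf {N | CanWin m n hm hn N x}

/-- `r̃(x)`: equal to the remoteness `r(x)` for `x ≠ g`, and to `m ^ n` for the goal
position `g` (its remoteness treated as a starting position). -/
noncomputable def rTilde (m n : ℕ) (hm : 1 ≤ m) (hn : 1 ≤ n) (x : Fin n → Fin m) : ℕ :=
  if x = goalPos m n hm then m ^ n else remoteness m n hm hn x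

/-- The window of length `n` of the cyclic sequence `w` starting at `k`:
`(w k, w (k+1), …, w (k+n−1))`. -/
def window (m n : ℕ) (w : ZMod (m ^ n) → Fin m) (k : ZMod (m ^ n)) : Fin n → Fin m :=
  fun i => w (k + (i : ℕ))

/-- `w` is an `m`-ary de Bruijn sequence of rank `n`: the map sending `k` to the
window of length `n` starting at `k` is a bijection onto `(Fin m)^n`. -/
def IsDeBruijn (m n : ℕ) (w : ZMod (m ^ n) → Fin m) : Prop :=
  Function.Bijective (window m n w)

/-- The word of length `m ^ n` read from the cyclic sequence `f` starting at `j`: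
`(f j, f (j+1), …, f (j + m^n − 1))`. -/
def wordFrom (m n : ℕ) (f : ZMod (m ^ n) → Fin m) (j : ZMod (m ^ n)) :
    Fin (m ^ n) → Fin m :=
  fun i => f (j + (i : ℕ))

section Remoteness

variable {α : Type*} [LinearOrder α] [BoundedOrder α]

/-- The inequalities that the remoteness of the warden's game satisfies on words of length `n`
other than the goal word. -/
structure IsRemoteness (n : ℕ) (r : List α → ℕ) : Prop where
  lt_of_lt : ∀ (l : List α) (b c : α), l.length + 1 = n → (∃ x ∈ l ++ [c], x ≠ ⊤) → b < c →
    r (b :: l) < r (l ++ [c])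
  exists_lt : ∀ (l : List α) (c : α), l.length + 1 = n → (∃ x ∈ l ++ [c], x ≠ ⊤) →
    ∃ b, c ≤ b ∧ r (b :: l) < r (l ++ [c])

namespace IsRemoteness

variable {n : ℕ} {r : List α → ℕ}

theorem replicate_top_append_le (h : IsRemoteness n r) (s : ℕ) :
    ∀ P : List α, P.length + s = n → (∃ x ∈ P, x ≠ ⊤) →
      r (List.replicate s ⊤ ++ P) + s ≤ r (P ++ List.replicate s ⊤) := by
  induction s with
  | zero => intro P _ _; simp
  | succ s ih =>
    intro P hP ⟨x, hx, hxt⟩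
    have h1 := ih (⊤ :: P) (by simp; omega) ⟨x, by simp [hx], hxt⟩
    obtain ⟨b, hb, h2⟩ := h.exists_lt (P ++ List.replicate s ⊤) ⊤ (by simp; omega)
      ⟨x, by simp [hx], hxt⟩
    obtain rfl := top_le_iff.mp hb
    have e1 : List.replicate (s + 1) (⊤ : α) ++ P = List.replicate s ⊤ ++ ⊤ :: P := by
      simp [List.replicate_succ']
    have e2 : P ++ List.replicate (s + 1) (⊤ : α) = (P ++ List.replicate s ⊤) ++ [⊤] := by
      simp [List.replicate_succ']
    rw [e1, e2]
    simp only [List.cons_append] at h1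
    omega

theorem exists_append_le (h : IsRemoteness n r) (u : List α) :
    ∀ l : List α, l.length + u.length = n → (∃ x ∈ l, x ≠ ⊤) →
      ∃ q : List α, q.length = u.length ∧ r (q ++ l) ≤ r (l ++ u) := by
  induction u using List.reverseRecOn with
  | nil => intro l _ _; exact ⟨[], by simp⟩
  | append_singleton u c ih =>
    intro l hl ⟨x, hx, hxt⟩
    simp only [List.length_append, List.length_singleton] at hl
    obtain ⟨b, -, h2⟩ := h.exists_lt (l ++ u) c (by simp; omega) ⟨x, by simp [hx], hxt⟩
    obtain ⟨q, hq, h3⟩ := ih (b :: l) (by simp; omega) ⟨x, by simp [hx], hxt⟩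
    refine ⟨q ++ [b], by simp [hq], ?_⟩
    simp only [List.append_assoc, List.cons_append, List.nil_append] at *
    omega

theorem eq_replicate_bot_or (P : List α) :
    P = List.replicate P.length ⊥ ∨ ∃ P' c j, P = P' ++ c :: List.replicate j ⊥ ∧ c ≠ ⊥ := by
  induction P using List.reverseRecOn with
  | nil => simp
  | append_singleton P c ih =>
    by_cases hc : c = ⊥
    · subst hc
      rcases ih with ih | ⟨P', c, j, ih, hc⟩
      · left
        rw [List.length_append, List.length_singleton, List.replicate_succ', ← ih]
      · right
        exact ⟨P', c, j + 1, by rw [ih, List.replicate_succ']; simp, hc⟩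
    · right
      exact ⟨P, c, 0, by simp, hc⟩

variable [Nontrivial α]

theorem replicate_bot_append_le (h : IsRemoteness n r) {t s : ℕ} (hn : t + (s + 1) = n) :
    ∀ P : List α, P.length = t → (∃ x ∈ P, x ≠ ⊤) →
      r (List.replicate t ⊥ ++ List.replicate (s + 1) ⊤) ≤ r (P ++ List.replicate (s + 1) ⊤) := by
  suffices H : ∀ N, ∀ P : List α, r (P ++ List.replicate (s + 1) ⊤) = N → P.length = t →
      (∃ x ∈ P, x ≠ ⊤) → r (List.replicate t ⊥ ++ List.replicate (s + 1) ⊤) ≤ N from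
    fun P h1 h2 => H _ P rfl h1 h2
  intro N
  induction N using Nat.strong_induction_on with
  | _ N ih =>
  intro P hN hP hPt
  have descend : ∀ Q : List α, r (Q ++ List.replicate (s + 1) ⊤) < N → Q.length = t → ⊥ ∈ Q →
      r (List.replicate t ⊥ ++ List.replicate (s + 1) ⊤) ≤ N := fun Q h1 h2 h3 =>
    (ih _ h1 Q rfl h2 ⟨⊥, h3, bot_ne_top⟩).trans h1.le
  rcases eq_replicate_bot_or P with hb | ⟨P', c, j, rfl, hc⟩
  · rw [hP] at hb
    rw [← hN, ← hb]
  simp only [List.length_append, List.length_cons, List.length_replicate] at hP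
  by_cases hPc : ∃ x ∈ P' ++ [c], x ≠ ⊤
  · have h1 := h.replicate_top_append_le (s + 1) (P' ++ c :: List.replicate j ⊥)
      (by simp; omega) hPt
    obtain ⟨x, hx, hxt⟩ := hPc
    obtain ⟨q, hq, h2⟩ := h.exists_append_le (List.replicate j ⊥)
      (List.replicate (s + 1) ⊤ ++ (P' ++ [c])) (by simp; omega)
      ⟨x, List.mem_append_right _ hx, hxt⟩
    have h3 := h.lt_of_lt (q ++ (List.replicate (s + 1) ⊤ ++ P')) ⊥ c
      (by simp [hq]; omega) ⟨x, by simp only [List.mem_append] at hx ⊢; tauto, hxt⟩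
      (bot_lt_iff_ne_bot.mpr hc)
    obtain ⟨q', hq', h4⟩ := h.exists_append_le P' (⊥ :: (q ++ List.replicate (s + 1) ⊤))
      (by simp [hq]; omega) ⟨⊥, by simp, bot_ne_top⟩
    refine descend (q' ++ ⊥ :: q) ?_ (by simp [hq, hq']; omega) (by simp)
    simp only [List.append_assoc, List.cons_append, List.nil_append, List.length_replicate] at *
    omega
  · push Not at hPc
    obtain rfl : c = ⊤ := hPc c (by simp)
    obtain ⟨i, rfl⟩ : ∃ i, P' = List.replicate i ⊤ :=
      ⟨_, List.eq_replicate_iff.mpr ⟨rfl, fun x hx => hPc x (by simp [hx])⟩⟩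
    obtain ⟨x, hx, hxt⟩ := hPt
    have e : List.replicate s (⊤ : α) ++ (List.replicate i ⊤ ++ ⊤ :: List.replicate j ⊥) =
        List.replicate (s + 1) ⊤ ++ (List.replicate i ⊤ ++ List.replicate j ⊥) := by
      rw [← List.append_assoc, ← List.append_assoc, ← List.singleton_append,
        ← List.append_assoc, ← List.replicate_one, List.replicate_append_replicate,
        List.replicate_append_replicate, List.replicate_append_replicate]
      congr 2; omega
    have h1 := h.replicate_top_append_le s
      ((List.replicate i ⊤ ++ ⊤ :: List.replicate j ⊥) ++ [⊤]) (by simp at hP ⊢; omega)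
      ⟨x, List.mem_append_left _ hx, hxt⟩
    have h2 := h.lt_of_lt
      (List.replicate s ⊤ ++ (List.replicate i ⊤ ++ ⊤ :: List.replicate j ⊥)) ⊥ ⊤
      (by simp at hP ⊢; omega) ⟨x, by simp only [List.mem_append] at hx ⊢; tauto, hxt⟩ bot_lt_top
    rw [e] at h2
    obtain ⟨q, hq, h3⟩ := h.exists_append_le (List.replicate i ⊤ ++ List.replicate j ⊥)
      (⊥ :: List.replicate (s + 1) ⊤) (by simp at hP ⊢; omega) ⟨⊥, by simp, bot_ne_top⟩
    refine descend (q ++ [⊥]) ?_ (by simp at hP hq ⊢; omega) (by simp)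
    rw [← List.append_assoc (List.replicate s _), e] at h1
    have e3 : (List.replicate i ⊤ ++ ⊤ :: List.replicate j ⊥ ++ [⊤]) ++ List.replicate s (⊤ : α) =
        (List.replicate i ⊤ ++ ⊤ :: List.replicate j ⊥) ++ List.replicate (s + 1) (⊤ : α) := by
      simp [List.replicate_succ]
    rw [e3, hN] at h1
    simp only [List.append_assoc, List.cons_append, List.nil_append, List.length_replicate] at *
    omega

theorem replicate_append_top_lt (h : IsRemoteness n r) {t s : ℕ} (hn : t + 1 + (s + 1) = n)
    {e : α} (he : e ≠ ⊥) (hg : ∃ x ∈ List.replicate t ⊥ ++ [e], x ≠ ⊤) :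
    r (List.replicate s ⊤ ++ List.replicate (t + 1) ⊥ ++ [⊤]) <
      r (List.replicate (s + 1) ⊤ ++ List.replicate t ⊥ ++ [e]) := by
  obtain ⟨x, hx, hxt⟩ := hg
  have h1 := h.lt_of_lt (List.replicate (s + 1) ⊤ ++ List.replicate t ⊥) ⊥ e (by simp; omega)
    ⟨x, by simp only [List.mem_append] at hx ⊢; tauto, hxt⟩ (bot_lt_iff_ne_bot.mpr he)
  obtain ⟨q, hq, h2⟩ := h.exists_append_le (List.replicate t ⊥)
    (⊥ :: List.replicate (s + 1) ⊤) (by simp; omega) ⟨⊥, by simp, bot_ne_top⟩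
  have h3 := h.replicate_bot_append_le hn (q ++ [⊥]) (by simp [hq]) ⟨⊥, by simp, bot_ne_top⟩
  have h4 := h.replicate_top_append_le s (List.replicate (t + 1) ⊥ ++ [⊤]) (by simp; omega)
    ⟨⊥, by simp, bot_ne_top⟩
  have e4 : (List.replicate (t + 1) ⊥ ++ [⊤]) ++ List.replicate s (⊤ : α) =
      List.replicate (t + 1) ⊥ ++ List.replicate (s + 1) ⊤ := by
    simp [List.replicate_succ]
  rw [e4] at h4
  simp only [List.append_assoc, List.cons_append, List.nil_append] at *
  omega

end IsRemoteness

end Remoteness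

section Positions

variable {M n : ℕ}

/-- The position whose entries are those of the list `l`. -/
noncomputable def posOfList (M n : ℕ) (l : List (Fin (M + 2))) : Fin n → Fin (M + 2) :=
  fun i => l.getD i ⊥

/-- The list `F k, …, F (k + n - 1)`. -/
def block {α : Type*} (F : ℕ → α) (k n : ℕ) : List α :=
  (List.range n).map fun i => F (k + i)

@[simp]
theorem length_block {α : Type*} (F : ℕ → α) (k n : ℕ) : (block F k n).length = n := by
  simp [block]

theorem block_succ {α : Type*} (F : ℕ → α) (k n : ℕ) :
    block F k (n + 1) = block F k n ++ [F (k + n)] := by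
  simp [block, List.range_succ]

theorem block_succ_left {α : Type*} (F : ℕ → α) (k n : ℕ) :
    block F k (n + 1) = F k :: block F (k + 1) n := by
  simp [block, List.range_succ_eq_map, Function.comp_def, add_assoc, add_comm 1]

theorem block_congr {α : Type*} {F G : ℕ → α} {k n : ℕ}
    (h : ∀ i < n, F (k + i) = G (k + i)) : block F k n = block G k n :=
  List.map_congr_left fun i hi => h i (List.mem_range.mp hi)

theorem posOfList_block (F : ℕ → Fin (M + 2)) (k : ℕ) :
    posOfList M n (block F k n) = fun i : Fin n => F (k + i) := by
  funext i
  simp [posOfList, block]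

theorem posOfList_injective {l l' : List (Fin (M + 2))} (hl : l.length = n) (hl' : l'.length = n)
    (h : posOfList M n l = posOfList M n l') : l = l' := by
  apply List.ext_getElem (hl.trans hl'.symm)
  intro i h1 h2
  have := congrFun h ⟨i, hl ▸ h1⟩
  simpa [posOfList, h1, h2] using this

theorem goalPos_eq (hm : 1 ≤ M + 2) :
    goalPos (M + 2) n hm = posOfList M n (List.replicate n ⊤) := by
  funext i
  simp [goalPos, posOfList]
  rfl

theorem posOfList_ne_goalPos (hm : 1 ≤ M + 2) {l : List (Fin (M + 2))} (hl : l.length = n)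
    (h : ∃ x ∈ l, x ≠ ⊤) : posOfList M n l ≠ goalPos (M + 2) n hm := by
  rw [goalPos_eq]
  intro e
  have := posOfList_injective hl (by simp) e
  subst this
  obtain ⟨x, hx, hxt⟩ := h
  exact hxt (List.eq_of_mem_replicate hx)

theorem shift_posOfList {l : List (Fin (M + 2))} (hl : l.length + 1 = n) (b c : Fin (M + 2)) :
    shift b (posOfList M n (l ++ [c])) = posOfList M n (b :: l) := by
  funext ⟨i, hi⟩
  rcases i with _ | i
  · simp [shift, posOfList]
  · have : i < l.length := by omega
    simp [shift, posOfList, List.getElem?_append_left this]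

theorem posOfList_append_last {l : List (Fin (M + 2))} (hl : l.length + 1 = n) (c : Fin (M + 2))
    (h : n - 1 < n) : posOfList M n (l ++ [c]) ⟨n - 1, h⟩ = c := by
  have : n - 1 = l.length := by omega
  simp [posOfList, this]

theorem CanWin.succ_iff (hm : 1 ≤ M + 2) (hn : 1 ≤ n) {l : List (Fin (M + 2))}
    (hl : l.length + 1 = n) {c : Fin (M + 2)} (hg : ∃ x ∈ l ++ [c], x ≠ ⊤) (N : ℕ) :
    CanWin (M + 2) n hm hn (N + 1) (posOfList M n (l ++ [c])) ↔
      (∀ b < c, CanWin (M + 2) n hm hn N (posOfList M n (b :: l))) ∧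
        ∃ b, c ≤ b ∧ CanWin (M + 2) n hm hn N (posOfList M n (b :: l)) := by
  rw [CanWin]
  simp only [posOfList_ne_goalPos hm (l := l ++ [c]) (by simpa using hl) hg, false_or,
    posOfList_append_last hl, shift_posOfList hl]

theorem canWin_remoteness (hm : 1 ≤ M + 2) (hn : 1 ≤ n) {x : Fin n → Fin (M + 2)}
    (h : 0 < remoteness (M + 2) n hm hn x) :
    CanWin (M + 2) n hm hn (remoteness (M + 2) n hm hn x) x :=
  Nat.sInf_mem (Nat.nonempty_of_pos_sInf h)

theorem remoteness_le (hm : 1 ≤ M + 2) (hn : 1 ≤ n) {x : Fin n → Fin (M + 2)} {N : ℕ}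
    (h : CanWin (M + 2) n hm hn N x) : remoteness (M + 2) n hm hn x ≤ N :=
  Nat.sInf_le h

theorem isRemoteness_remoteness (hm : 1 ≤ M + 2) (hn : 1 ≤ n)
    (hpos : ∀ x, x ≠ goalPos (M + 2) n hm → 0 < remoteness (M + 2) n hm hn x) :
    IsRemoteness n fun l => remoteness (M + 2) n hm hn (posOfList M n l) := by
  have key : ∀ (l : List (Fin (M + 2))) (c : Fin (M + 2)), l.length + 1 = n →
      (∃ x ∈ l ++ [c], x ≠ ⊤) → ∃ N, remoteness (M + 2) n hm hn (posOfList M n (l ++ [c])) = N + 1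
        ∧ CanWin (M + 2) n hm hn (N + 1) (posOfList M n (l ++ [c])) := by
    intro l c hl hg
    have h1 := hpos _ (posOfList_ne_goalPos hm (l := l ++ [c]) (by simpa using hl) hg)
    obtain ⟨N, hN⟩ := Nat.exists_eq_succ_of_ne_zero h1.ne'
    exact ⟨N, hN, by simpa only [hN] using canWin_remoteness hm hn h1⟩
  constructor
  · intro l b c hl hg hbc
    obtain ⟨N, h1, h2⟩ := key l c hl hg
    have := remoteness_le hm hn (((CanWin.succ_iff hm hn hl hg N).mp h2).1 b hbc)
    omega
  · intro l c hl hg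
    obtain ⟨N, h1, h2⟩ := key l c hl hg
    obtain ⟨b, hcb, hb⟩ := ((CanWin.succ_iff hm hn hl hg N).mp h2).2
    have := remoteness_le hm hn hb
    exact ⟨b, hcb, by omega⟩

theorem remoteness_append_mono (hm : 1 ≤ M + 2) (hn : 1 ≤ n)
    (hpos : ∀ x, x ≠ goalPos (M + 2) n hm → 0 < remoteness (M + 2) n hm hn x)
    {l : List (Fin (M + 2))} (hl : l.length + 1 = n) {c c' : Fin (M + 2)} (hc : c < c')
    (hg : ∃ x ∈ l ++ [c'], x ≠ ⊤) :
    remoteness (M + 2) n hm hn (posOfList M n (l ++ [c])) ≤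
      remoteness (M + 2) n hm hn (posOfList M n (l ++ [c'])) := by
  have h1 := hpos _ (posOfList_ne_goalPos hm (l := l ++ [c']) (by simpa using hl) hg)
  have h2 := canWin_remoteness hm hn h1
  apply remoteness_le
  obtain ⟨N, hN⟩ := Nat.exists_eq_succ_of_ne_zero h1.ne'
  rw [hN, Nat.succ_eq_add_one, CanWin.succ_iff hm hn hl hg] at h2
  rw [hN, Nat.succ_eq_add_one, CanWin.succ_iff hm hn hl ⟨c, by simp, (hc.trans_le le_top).ne⟩]
  obtain ⟨b, hb, h3⟩ := h2.2
  exact ⟨fun b hb => h2.1 b (hb.trans hc), b, hc.le.trans hb, h3⟩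

theorem CanWin.eq_top (hm : 1 ≤ M + 2) (hn : 1 ≤ n) (N : ℕ) :
    ∀ x, CanWin (M + 2) n hm hn N x → ∀ i : Fin n, (i : ℕ) + N < n → x i = ⊤ := by
  induction N with
  | zero =>
    rintro x rfl i _
    rfl
  | succ N ih =>
    rintro x (rfl | ⟨-, c, -, hc⟩) i hi
    · rfl
    · have := ih _ hc ⟨i + 1, by omega⟩ (by simp only; omega)
      simpa [shift] using this

theorem canWin_replicate (hm : 1 ≤ M + 2) (hn : 1 ≤ n) (t : ℕ) :
    ∀ s, s + t = n → CanWin (M + 2) n hm hn t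
      (posOfList M n (List.replicate s ⊤ ++ List.replicate t ⊥)) := by
  induction t with
  | zero =>
    rintro s rfl
    rw [CanWin, goalPos_eq]
    simp
  | succ t ih =>
    intro s hs
    rw [List.replicate_succ', ← List.append_assoc,
      CanWin.succ_iff hm hn (by simp; omega) ⟨⊥, by simp, bot_ne_top⟩]
    refine ⟨fun b hb => (not_lt_bot hb).elim, ⊤, bot_le, ?_⟩
    exact ih (s + 1) (by omega)

theorem remoteness_replicate (hm : 1 ≤ M + 2) (hn : 1 ≤ n) {s t : ℕ} (h : s + t = n) :
    remoteness (M + 2) n hm hn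
      (posOfList M n (List.replicate s ⊤ ++ List.replicate t ⊥)) = t := by
  have h1 := canWin_replicate hm hn t s h
  refine le_antisymm (remoteness_le hm hn h1) ?_
  rcases Nat.eq_zero_or_pos t with rfl | ht
  · exact Nat.zero_le _
  have h2 : remoteness (M + 2) n hm hn
      (posOfList M n (List.replicate s ⊤ ++ List.replicate t ⊥)) ∈ {N | CanWin (M + 2) n hm hn N
        (posOfList M n (List.replicate s ⊤ ++ List.replicate t ⊥))} := Nat.sInf_mem ⟨t, h1⟩
  by_contra! hlt
  have h3 := CanWin.eq_top hm hn _ _ h2 ⟨s, by omega⟩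
    (by simp only; omega)
  simp [posOfList] at h3
  rw [List.getElem?_append_right (by simp)] at h3
  simp [show 0 < t by omega] at h3

end Positions

section LexMin

variable {α : Type*} [LinearOrder α] [BoundedOrder α]

/-- `W` is the sequence of blocks sorted by the ranking `T` (with the block of rank `n` at `0`),
where `T` has the order properties of the remoteness of the warden's game. -/
structure IsRanking (n L : ℕ) (T : List α → ℕ) (W : ℕ → α) : Prop where
  pos : ∀ l, l.length = n → 0 < T l
  inj : ∀ l l', l.length = n → l'.length = n → T l = T l' → l = l'
  block_eq : ∀ l, l.length = n → n ≤ T l → block W (T l - n) n = l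
  rank_block : ∀ k, k + n ≤ L → T (block W k n) = k + n
  mono : ∀ (l : List α) (c c' : α), l.length + 1 = n → c < c' → T (l ++ [c]) < T (l ++ [c'])
  rank_replicate : ∀ s t, 0 < t → s + t = n → T (List.replicate s ⊤ ++ List.replicate t ⊥) = t
  rank_lt : ∀ (t s : ℕ) (e : α), t + 1 + (s + 1) = n → e ≠ ⊥ →
    T (List.replicate s ⊤ ++ List.replicate (t + 1) ⊥ ++ [⊤]) <
      T (List.replicate (s + 1) ⊤ ++ List.replicate t ⊥ ++ [e])

namespace IsRanking

theorem le_of_agree {n L : ℕ} {T : List α → ℕ} {W F : ℕ → α} (h : IsRanking n L T W) (hn : 1 ≤ n)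
    (hF : ∀ k < L, ∀ k' < L, block F k n = block F k' n → k = k') {i : ℕ} (hi : i < L)
    (hag : ∀ l < i, F l = W l) : W i ≤ F i := by
  by_contra! hlt
  obtain ⟨d, rfl⟩ : ∃ d, n = d + 1 := ⟨n - 1, by omega⟩
  have hzero : block W 0 (d + 1) = List.replicate (d + 1) ⊥ := by
    have h1 := h.rank_replicate 0 (d + 1) (by omega) (by omega)
    have h2 := h.block_eq (List.replicate 0 ⊤ ++ List.replicate (d + 1) ⊥) (by simp) h1.ge
    rw [h1] at h2
    simpa using h2
  rcases Nat.lt_or_ge i (d + 1) with hid | hid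
  · have h1 : W i ∈ block W 0 (d + 1) := List.mem_map.mpr ⟨i, by simpa using hid, by simp⟩
    rw [hzero] at h1
    rw [List.eq_of_mem_replicate h1] at hlt
    exact not_lt_bot hlt
  obtain ⟨k, rfl⟩ : ∃ k, i = k + d := ⟨i - d, by omega⟩
  have hrepeat : ∀ l : List α, l.length = d + 1 → d + 1 ≤ T l → T l ≤ k + d → ∀ k' < L, k ≤ k' →
      block F k' (d + 1) ≠ l := by
    intro l hl h1 h2 k' hk' hkk' heq
    have h3 := h.block_eq l hl h1
    have h4 : block F (T l - (d + 1)) (d + 1) = block W (T l - (d + 1)) (d + 1) :=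
      block_congr fun j hj => hag _ (by omega)
    have := hF _ (by omega) k' hk' (h4.trans (h3.trans heq.symm))
    omega
  have hFW : block F k d = block W k d := block_congr fun j hj => hag _ (by omega)
  have hTW : T (block F k d ++ [W (k + d)]) = k + d + 1 := by
    rw [hFW, ← block_succ]
    exact h.rank_block k (by omega)
  have hTF : T (block F k (d + 1)) < k + d + 1 := by
    rw [← hTW, block_succ]
    exact h.mono _ _ _ (by simp) hlt
  rcases Nat.lt_or_ge (T (block F k (d + 1))) (d + 1) with ht | ht
  swap
  · exact hrepeat _ (by simp) ht (by omega) k (by omega) le_rfl rfl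
  obtain ⟨t, hTt⟩ := Nat.exists_eq_succ_of_ne_zero (h.pos (block F k (d + 1)) (by simp)).ne'
  obtain ⟨s, hs⟩ : ∃ s, t + 1 + (s + 1) = d + 1 := ⟨d + 1 - (t + 1) - 1, by omega⟩
  have hz : block F k (d + 1) = List.replicate (s + 1) ⊤ ++ List.replicate (t + 1) ⊥ :=
    h.inj _ _ (by simp) (by simp; omega)
      (hTt.trans (h.rank_replicate (s + 1) (t + 1) (by omega) (by omega)).symm)
  have hA : T (List.replicate s ⊤ ++ List.replicate (t + 1) ⊥ ++ [⊤]) ≤ k + d := by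
    have h2 := h.rank_lt t s (W (k + d)) hs (ne_bot_of_gt hlt)
    rw [List.replicate_succ' (n := t), ← List.append_assoc] at hz
    rw [block_succ] at hz
    rw [← (List.append_inj' hz rfl).1, hTW] at h2
    omega
  have claim : ∀ j s', s' + j = s + 1 →
      block F (k + j) (d + 1) = List.replicate s' ⊤ ++ List.replicate (t + 1 + j) ⊥ ∧
      ∀ s'', s' = s'' + 1 →
        T (List.replicate s'' ⊤ ++ List.replicate (t + 1 + j) ⊥ ++ [⊤]) ≤ k + d := by
    intro j
    induction j with
    | zero =>
      rintro s' hs'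
      obtain rfl : s' = s + 1 := hs'
      refine ⟨hz, fun s'' hs'' => ?_⟩
      obtain rfl : s = s'' := by omega
      exact hA
    | succ j ih =>
      intro s' hs'
      obtain ⟨h1, h2⟩ := ih (s' + 1) (by omega)
      replace h2 := h2 s' rfl
      rw [block_succ_left, List.replicate_succ, List.cons_append] at h1
      have h3 := (List.cons.inj h1).2
      constructor
      · rw [← add_assoc, block_succ, h3, ← add_assoc, List.replicate_succ', ← List.append_assoc]
        congr 2
        by_contra he
        have hle : T (List.replicate s' ⊤ ++ List.replicate (t + 1 + j) ⊥ ++ [F (k + j + 1 + d)]) ≤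
            k + d := by
          rcases eq_or_ne (F (k + j + 1 + d)) ⊤ with e | e
          · rw [e]; exact h2
          · exact (h.mono _ _ _ (by simp; omega) (lt_top_iff_ne_top.mpr e)).le.trans h2
        refine hrepeat _ (by simp; omega) ?_ hle (k + j + 1) (by omega) (by omega)
          (by rw [block_succ, h3])
        by_contra! hlt'
        have hp := h.pos (List.replicate s' ⊤ ++ List.replicate (t + 1 + j) ⊥ ++
          [F (k + j + 1 + d)]) (by simp; omega)
        obtain ⟨τ, hτ⟩ := Nat.exists_eq_succ_of_ne_zero hp.ne'
        have h4 := h.inj _ (List.replicate (d - τ) ⊤ ++ List.replicate (τ + 1) ⊥)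
          (by simp; omega) (by simp; omega)
          (hτ.trans (h.rank_replicate (d - τ) (τ + 1) (by omega) (by omega)).symm)
        rw [List.replicate_succ' (n := τ), ← List.append_assoc] at h4
        exact he (List.cons.inj (List.append_inj' h4 rfl).2).1
      · rintro s'' rfl
        have := h.rank_lt (t + 1 + j) s'' ⊤ (by omega)
          (fun e => not_lt_bot (hlt.trans_le (le_top.trans e.le)))
        rw [← add_assoc]
        omega
  have h1 := (claim (s + 1) 0 (by omega)).1
  have h2 : block F 0 (d + 1) = block W 0 (d + 1) := block_congr fun j hj => hag _ (by omega)
  rw [show t + 1 + (s + 1) = d + 1 by omega, List.replicate_zero, List.nil_append, ← hzero,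
    ← h2] at h1
  have := hF _ (by omega) _ (by omega) h1
  omega

end IsRanking

end LexMin

section Warden

variable {M n : ℕ}

theorem block_eq_iff_window (f : ZMod ((M + 2) ^ n) → Fin (M + 2)) (j : ZMod ((M + 2) ^ n)) (k : ℕ)
    {l : List (Fin (M + 2))} (hl : l.length = n) :
    block (fun i : ℕ => f (j + (i : ZMod ((M + 2) ^ n)))) k n = l ↔
      window (M + 2) n f (j + k) = posOfList M n l := by
  have h : posOfList M n (block (fun i : ℕ => f (j + (i : ZMod ((M + 2) ^ n)))) k n) =
      window (M + 2) n f (j + k) := by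
    rw [posOfList_block]
    funext i
    simp [window, add_assoc]
  rw [← h]
  exact ⟨fun e => by rw [e], posOfList_injective (by simp) hl⟩

theorem isRanking_rTilde (hm : 1 ≤ M + 2) (hn : 1 ≤ n) (w : ZMod ((M + 2) ^ n) → Fin (M + 2))
    (hw : ∀ k : ZMod ((M + 2) ^ n), ∀ x : Fin n → Fin (M + 2),
        window (M + 2) n w k = x ↔
          rTilde (M + 2) n hm hn x = (k.val + n - 1) % (M + 2) ^ n + 1) :
    IsRanking n ((M + 2) ^ n) (fun l => rTilde (M + 2) n hm hn (posOfList M n l))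
      fun i => w (0 + (i : ZMod ((M + 2) ^ n))) := by
  have hnL : n < (M + 2) ^ n := Nat.lt_pow_self (by omega)
  have : NeZero ((M + 2) ^ n) := ⟨by omega⟩
  have hinj : Function.Injective (window (M + 2) n w) := by
    intro k k' hkk
    have h1 := (hw k _).mp rfl
    have h2 := (hw k' _).mp hkk.symm
    have h3 : k.val + n - 1 ≡ k'.val + n - 1 [MOD (M + 2) ^ n] := by unfold Nat.ModEq; omega
    rw [Nat.add_sub_assoc hn, Nat.add_sub_assoc hn] at h3
    have h4 := Nat.ModEq.add_right_cancel' _ h3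
    rw [Nat.ModEq, Nat.mod_eq_of_lt (ZMod.val_lt k), Nat.mod_eq_of_lt (ZMod.val_lt k')] at h4
    exact ZMod.val_injective _ h4
  have hsurj : Function.Surjective (window (M + 2) n w) :=
    ((Fintype.bijective_iff_injective_and_card _).mpr
      ⟨hinj, by rw [ZMod.card, Fintype.card_fun, Fintype.card_fin, Fintype.card_fin]⟩).2
  have hpos : ∀ x, 0 < rTilde (M + 2) n hm hn x := by
    intro x
    obtain ⟨k, hk⟩ := hsurj x
    rw [(hw k x).mp hk]
    exact Nat.succ_pos _
  have hle : ∀ x, rTilde (M + 2) n hm hn x ≤ (M + 2) ^ n := by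
    intro x
    obtain ⟨k, hk⟩ := hsurj x
    rw [(hw k x).mp hk]
    exact Nat.mod_lt _ (by omega)
  have hTinj : ∀ x x', rTilde (M + 2) n hm hn x = rTilde (M + 2) n hm hn x' → x = x' := by
    intro x x' hx
    obtain ⟨k, hk⟩ := hsurj x
    rw [(hw k x).mp hk] at hx
    rw [← hk, (hw k x').mpr hx.symm]
  have hrT : ∀ x, x ≠ goalPos (M + 2) n hm →
      rTilde (M + 2) n hm hn x = remoteness (M + 2) n hm hn x := fun x hx => if_neg hx
  have hg : rTilde (M + 2) n hm hn (goalPos (M + 2) n hm) = (M + 2) ^ n := if_pos rfl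
  have hrpos : ∀ x, x ≠ goalPos (M + 2) n hm → 0 < remoteness (M + 2) n hm hn x :=
    fun x hx => hrT x hx ▸ hpos x
  have hlt_goal : ∀ x, x ≠ goalPos (M + 2) n hm →
      rTilde (M + 2) n hm hn x < rTilde (M + 2) n hm hn (goalPos (M + 2) n hm) := fun x hx =>
    lt_of_le_of_ne (hg ▸ hle x) fun e => hx (hTinj _ _ e)
  have hngoal : ∀ {l : List (Fin (M + 2))}, l.length = n → (∃ x ∈ l, x ≠ ⊤) →
      posOfList M n l ≠ goalPos (M + 2) n hm := fun hl h => posOfList_ne_goalPos hm hl h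
  have hcases : ∀ l : List (Fin (M + 2)), l.length = n →
      (∃ x ∈ l, x ≠ ⊤) ∨ posOfList M n l = goalPos (M + 2) n hm := by
    intro l hl
    by_cases h : ∃ x ∈ l, x ≠ ⊤
    · exact Or.inl h
    · push Not at h
      right
      rw [goalPos_eq, List.eq_replicate_iff.mpr ⟨hl, h⟩]
  constructor
  · exact fun l _ => hpos _
  · exact fun l l' hl hl' h => posOfList_injective hl hl' (hTinj _ _ h)
  · intro l hl hnT
    have h1 := hpos (posOfList M n l)
    have h2 := hle (posOfList M n l)
    rw [block_eq_iff_window w 0 _ hl, hw, zero_add, ZMod.val_natCast, Nat.mod_eq_of_lt (a := _ - n)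
      (by omega), Nat.mod_eq_of_lt (by omega)]
    omega
  · intro k hk
    have h1 := (block_eq_iff_window w 0 k (l := block (fun i : ℕ => w (0 + (i : ZMod ((M + 2) ^ n)))) k n)
      (by simp)).mp rfl
    rw [hw, zero_add, ZMod.val_natCast, Nat.mod_eq_of_lt (a := k) (by omega),
      Nat.mod_eq_of_lt (by omega)] at h1
    omega
  · intro l c c' hl hc
    have h0 := hngoal (l := l ++ [c]) (by simpa using hl) ⟨c, by simp, (hc.trans_le le_top).ne⟩
    rcases hcases (l ++ [c']) (by simpa using hl) with h | h
    · refine lt_of_le_of_ne ?_ fun e => hc.ne ?_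
      · rw [hrT _ h0, hrT _ (hngoal (by simpa using hl) h)]
        exact remoteness_append_mono hm hn hrpos hl hc h
      · simpa using posOfList_injective (by simpa using hl) (by simpa using hl) (hTinj _ _ e)
    · simp only [h]
      exact hlt_goal _ h0
  · intro s t ht hst
    rw [hrT _ (hngoal (by simp; omega) ⟨⊥, by simp; omega, bot_ne_top⟩),
      remoteness_replicate hm hn hst]
  · intro t s e hst he
    have h0 := hngoal (l := List.replicate s ⊤ ++ List.replicate (t + 1) ⊥ ++ [⊤])
      (by simp; omega) ⟨⊥, by simp, bot_ne_top⟩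
    rcases hcases (List.replicate (s + 1) ⊤ ++ List.replicate t ⊥ ++ [e]) (by simp; omega)
      with h | h
    · rw [hrT _ h0, hrT _ (hngoal (by simp; omega) h)]
      obtain ⟨x, hx, hxt⟩ := h
      refine (isRemoteness_remoteness hm hn hrpos).replicate_append_top_lt hst he ⟨x, ?_, hxt⟩
      simp only [List.mem_append] at hx ⊢
      rcases hx with (hx | hx) | hx
      · exact (hxt (List.eq_of_mem_replicate hx)).elim
      · exact Or.inl hx
      · exact Or.inr hx
    · simp only [h]
      exact hlt_goal _ h0

end Warden

/-- The warden's sequence is the lexicographically minimal `m`-ary de Bruijn sequence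
of rank `n`: its full word (read from 0) is lexicographically `≤` the full word of any
de Bruijn sequence read from any starting point. -/
theorem warden_deBruijn_lex_min (m n : ℕ) (hm : 1 ≤ m) (hn : 1 ≤ n)
    (w : ZMod (m ^ n) → Fin m)
    (hw : ∀ k : ZMod (m ^ n), ∀ x : Fin n → Fin m,
        window m n w k = x ↔ rTilde m n hm hn x = (k.val + n - 1) % m ^ n + 1) :
    ∀ f : ZMod (m ^ n) → Fin m, IsDeBruijn m n f → ∀ j : ZMod (m ^ n),
      toLex (wordFrom m n w 0) ≤ toLex (wordFrom m n f j) := by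
  intro f hf j
  obtain rfl | ⟨M, rfl⟩ : m = 1 ∨ ∃ M, m = M + 2 := by
    rcases hm.eq_or_lt with h | h
    · exact Or.inl h.symm
    · exact Or.inr ⟨m - 2, by omega⟩
  · exact (congrArg toLex (Subsingleton.elim _ _)).le
  by_contra! hlt
  obtain ⟨i, hag, hi⟩ := hlt
  have hne : NeZero ((M + 2) ^ n) := ⟨by positivity⟩
  refine not_le_of_gt hi ((isRanking_rTilde hm hn w hw).le_of_agree hn
    (F := fun l : ℕ => f (j + (l : ZMod ((M + 2) ^ n)))) ?_ i.isLt fun l hl =>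
      hag ⟨l, hl.trans i.isLt⟩ hl)
  intro k hk k' hk' h
  rw [block_eq_iff_window f j k (by simp),
    ← (block_eq_iff_window f j k' (by simp)).mp rfl] at h
  have h1 := add_left_cancel (hf.1 h)
  rwa [ZMod.natCast_eq_natCast_iff', Nat.mod_eq_of_lt hk, Nat.mod_eq_of_lt hk'] at h1
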